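/- The function g(d1, d2) = exp(d1 + d2) − exp(d1) − exp(d2) attains its maximum over the simplex D = {(d1, d2) : d1 ≥ 0, d2 ≥ 0, d1 + d2 ≤ 1} at the point (d1, d2) = (1/2, 1/2), where it equals exp(1) − 2·exp(1/2), and this maximum value is strictly negative. -/

import Mathlib

theorem g_max_at_half_half :
    let g : ℝ × ℝ → ℝ := fun p => Real.exp (p.1 + p.2) - Real.exp p.1 - Real.exp p.2
    let D : Set (ℝ × ℝ) := {p | 0 ≤ p.1 ∧ 0 ≤ p.2 ∧ p.1 + p.2 ≤ 1}
    ((1 / 2 : ℝ), (1 / 2 : ℝ)) ∈ D ∧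
    IsMaxOn g D ((1 / 2 : ℝ), (1 / 2 : ℝ)) ∧
    g ((1 / 2 : ℝ), (1 / 2 : ℝ)) = Real.exp 1 - 2 * Real.exp (1 / 2) ∧
    g ((1 / 2 : ℝ), (1 / 2 : ℝ)) < 0 := by
  intro g D
  have exp_eq_sq (x : ℝ) : Real.exp x = Real.exp (x / 2) ^ 2 := by
    rw [← Real.exp_nat_mul]
    congr 1
    push_cast
    ring
  have hg : g ((1 / 2 : ℝ), (1 / 2 : ℝ)) = Real.exp 1 - 2 * Real.exp (1 / 2) := by
    simp only [g, add_halves]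
    ring
  refine ⟨by norm_num [D], ?_, hg, ?_⟩
  · rintro ⟨x, y⟩ ⟨hx, hy, hxy⟩
    simp only at hx hy hxy
    change g (x, y) ≤ g (1 / 2, 1 / 2)
    rw [hg]
    simp only [g]
    have hmul : Real.exp ((x + y) / 2) = Real.exp (x / 2) * Real.exp (y / 2) := by
      rw [← Real.exp_add, add_div]
    have h_one_le : 1 ≤ Real.exp ((x + y) / 2) := Real.one_le_exp (by linarith)
    have h_le : Real.exp ((x + y) / 2) ≤ Real.exp (1 / 2) := Real.exp_le_exp.mpr (by linarith)
    have amgm : 2 * Real.exp ((x + y) / 2) ≤ Real.exp x + Real.exp y := by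
      rw [exp_eq_sq x, exp_eq_sq y, hmul]
      linarith [two_mul_le_add_sq (Real.exp (x / 2)) (Real.exp (y / 2))]
    rw [exp_eq_sq (x + y), exp_eq_sq 1]
    nlinarith
  · have h_lt : Real.exp (1 / 2) < 2 := by
      nlinarith [exp_eq_sq 1, Real.exp_one_lt_d9, Real.exp_pos (1 / 2)]
    rw [hg, exp_eq_sq 1]
    nlinarith [Real.exp_pos (1 / 2)]
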